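/- Let G be a finite simple bipartite graph with nonempty partite sets U and W. For u ∈ U and Y ⊆ W, let d_Y(u) denote the number of neighbors of u in Y, and let K := max over nonempty Y ⊆ W of ρ((d_Y(u))_{u∈U}). Then M(G) ≤ λmax(G) ≤ √(2·(log K + 1)·(log|W| + 4))·M(G). -/

import Mathlib

-- `lamMax G`: the largest eigenvalue of the adjacency matrix of `G`.
open Classical in
noncomputable def lamMax {V : Type*} [Fintype V] (G : SimpleGraph V) : ℝ :=
  sSup (spectrum ℝ (G.adjMatrix ℝ))

-- `eXY G X Y = e(X,Y)`: the number of ordered pairs `(x,y) ∈ X × Y` with `x` adjacent to `y`.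
open Classical in
noncomputable def eXY {V : Type*} (G : SimpleGraph V) (X Y : Finset V) : ℕ :=
  ((X ×ˢ Y).filter fun p => G.Adj p.1 p.2).card

/-- `M(G)`: the maximum of `e(X,Y)/√(|X||Y|)` over nonempty `X, Y ⊆ V`. -/
noncomputable def MG {V : Type*} (G : SimpleGraph V) : ℝ :=
  sSup {r : ℝ | ∃ X Y : Finset V, X.Nonempty ∧ Y.Nonempty ∧
    r = (eXY G X Y : ℝ) / Real.sqrt ((X.card : ℝ) * (Y.card : ℝ))}

-- `rho d = ρ(d)` for a finite sequence `d` with non-negative terms: with `d₁ ≥ … ≥ dₙ`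
-- the non-increasing rearrangement of `d` and `k` the smallest index (1-based) with
-- `d₁² + … + d_k² ≥ d_{k+1}² + … + dₙ²`, `ρ(d) = d₁ / d_k` if `d_k ≠ 0`, else `ρ(d) = 1`.
open Classical in
noncomputable def rho {n : ℕ} (d : Fin n → ℝ) : ℝ :=
  if hn : 0 < n then
    -- `s` is the non-increasing rearrangement of `d`
    let s : Fin n → ℝ := fun i => d (Tuple.sort d i.rev)
    -- `k` is the smallest (0-based) index with `s 0 ^ 2 + … + s k ^ 2 ≥` the remaining sum
    let k : Fin n := ⟨min (sInf {k : ℕ |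
        ∑ i : Fin n, (if k < (i : ℕ) then s i ^ 2 else 0) ≤
        ∑ i : Fin n, (if (i : ℕ) ≤ k then s i ^ 2 else 0)}) (n - 1),
      lt_of_le_of_lt (min_le_right _ _) (Nat.sub_lt hn one_pos)⟩
    if s k ≠ 0 then s ⟨0, hn⟩ / s k else 1
  else 1

/-- A decreasing sequence whose partial sums satisfy `t 0 + … + t j ≤ m √(j + 1)` has its
sum of squares controlled by the logarithm of the ratio of its extreme terms. -/
lemma sum_sq_le_of_partial_sums_le {t : ℕ → ℝ} (ht : Antitone t) {m : ℝ} (k : ℕ) (hk : 0 < t k)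
    (hP : ∀ j ≤ k, ∑ i ∈ Finset.range (j + 1), t i ≤ m * √((j : ℝ) + 1)) :
    ∑ i ∈ Finset.range (k + 1), t i ^ 2 ≤ m ^ 2 * (1 + Real.log (t 0 / t k)) := by
  have hpos : ∀ j ≤ k, 0 < t j := fun j hj => hk.trans_le (ht hj)
  have hmul : ∀ j ≤ k, t j * ∑ i ∈ Finset.range (j + 1), t i ≤ m ^ 2 := by
    intro j hj
    have h1 : ((j : ℝ) + 1) * t j ≤ ∑ i ∈ Finset.range (j + 1), t i := by
      have := Finset.card_nsmul_le_sum (Finset.range (j + 1)) t (t j)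
        fun i hi => ht (Nat.lt_succ_iff.mp (Finset.mem_range.mp hi))
      simpa using this
    have h2 := hP j hj
    have h3 := hpos j hj
    have h4 : √((j : ℝ) + 1) ^ 2 = (j : ℝ) + 1 := Real.sq_sqrt (by positivity)
    have h5 : 0 < √((j : ℝ) + 1) := by positivity
    have h6 : t j * √((j : ℝ) + 1) ≤ m := by
      refine le_of_mul_le_mul_right ?_ h5
      nlinarith
    have h7 : 0 ≤ t j * √((j : ℝ) + 1) := by positivity
    calc t j * ∑ i ∈ Finset.range (j + 1), t i ≤ t j * (m * √((j : ℝ) + 1)) := by gcongr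
      _ = (t j * √((j : ℝ) + 1)) * m := by ring
      _ ≤ m * m := by gcongr
                      linarith
      _ = m ^ 2 := by ring
  have key : ∀ j ≤ k, ∑ i ∈ Finset.range (j + 1), t i ^ 2 ≤
      t j * ∑ i ∈ Finset.range (j + 1), t i + m ^ 2 * Real.log (t 0 / t j) := by
    intro j
    induction j with
    | zero =>
      intro h
      have := (hpos 0 h).ne'
      simp [this, sq]
    | succ j ih =>
      intro h
      have hj := hpos j (by omega)
      have hj1 := hpos (j + 1) h
      have h0 := hpos 0 (by omega)
      have hlog : Real.log (t 0 / t (j + 1)) =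
          Real.log (t 0 / t j) + Real.log (t j / t (j + 1)) := by
        rw [← Real.log_mul (by positivity) (by positivity)]
        congr 1
        field_simp
      have h1 : 1 - t (j + 1) / t j ≤ Real.log (t j / t (j + 1)) := by
        simpa using Real.one_sub_inv_le_log_of_pos (div_pos hj hj1)
      have h2 : (t j - t (j + 1)) * ∑ i ∈ Finset.range (j + 1), t i ≤
          m ^ 2 * (1 - t (j + 1) / t j) := by
        have h3 : 0 ≤ 1 - t (j + 1) / t j := by
          rw [sub_nonneg, div_le_one hj]
          exact ht (Nat.le_succ j)
        calc _ = (t j * ∑ i ∈ Finset.range (j + 1), t i) * (1 - t (j + 1) / t j) := by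
              field_simp
          _ ≤ _ := by gcongr; exact hmul j (by omega)
      have h4 := mul_le_mul_of_nonneg_left h1 (sq_nonneg m)
      rw [Finset.sum_range_succ _ (j + 1), Finset.sum_range_succ t (j + 1), hlog]
      linarith [ih (by omega)]
  linarith [key k le_rfl, hmul k le_rfl]

/-- If `∑ i ∈ X, d i ≤ m √|X|` for all `X`, then `∑ d i ^ 2 ≤ 2 m² (1 + log ρ(d))`. -/
lemma one_le_rho_and_sum_sq_le {n : ℕ} (d : Fin n → ℝ) (hd : ∀ i, 0 ≤ d i) (m : ℝ)
    (hX : ∀ X : Finset (Fin n), ∑ i ∈ X, d i ≤ m * √(X.card : ℝ)) :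
    1 ≤ rho d ∧ ∑ i, d i ^ 2 ≤ 2 * m ^ 2 * (1 + Real.log (rho d)) := by
  classical
  rcases Nat.eq_zero_or_pos n with rfl | hn
  · simp [rho, sq_nonneg]
  set e : Fin n ≃ Fin n := Fin.revPerm.trans (Tuple.sort d)
  set s : Fin n → ℝ := fun i => d (Tuple.sort d i.rev)
  have hs_anti : Antitone s := fun i j hij => Tuple.monotone_sort d (Fin.rev_le_rev.mpr hij)
  have hs0 : ∀ i, 0 ≤ s i := fun i => hd _
  have hsum : ∑ i, s i ^ 2 = ∑ i, d i ^ 2 := Equiv.sum_comp e fun i => d i ^ 2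
  set S : Set ℕ := {k : ℕ |
        ∑ i : Fin n, (if k < (i : ℕ) then s i ^ 2 else 0) ≤
        ∑ i : Fin n, (if (i : ℕ) ≤ k then s i ^ 2 else 0)}
  have hmemS : ∀ k : ℕ, k ∈ S ↔ ∑ i : Fin n, (if k < (i : ℕ) then s i ^ 2 else 0) ≤
      ∑ i : Fin n, (if (i : ℕ) ≤ k then s i ^ 2 else 0) := fun _ => Iff.rfl
  have hsplit : ∀ k : ℕ, ∑ i : Fin n, (if k < (i : ℕ) then s i ^ 2 else 0) +
      ∑ i : Fin n, (if (i : ℕ) ≤ k then s i ^ 2 else 0) = ∑ i, s i ^ 2 := by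
    intro k
    rw [← Finset.sum_add_distrib]
    refine Finset.sum_congr rfl fun i _ => ?_
    by_cases h : (i : ℕ) ≤ k
    · simp [h, not_lt.mpr h]
    · simp [h, not_le.mp h]
  have hmem : n - 1 ∈ S := by
    rw [hmemS]
    refine Finset.sum_le_sum fun i _ => ?_
    have h1 : ¬ (n - 1 < (i : ℕ)) := by omega
    rw [if_neg h1, if_pos (not_lt.mp h1)]
    positivity
  have hle : sInf S ≤ n - 1 := Nat.sInf_le hmem
  obtain ⟨k, hk⟩ : ∃ k : Fin n, (k : ℕ) = sInf S :=
    ⟨⟨sInf S, by omega⟩, rfl⟩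
  have hrho : rho d = if s k ≠ 0 then s ⟨0, hn⟩ / s k else 1 := by
    have hk' : k = ⟨min (sInf S) (n - 1),
        lt_of_le_of_lt (min_le_right _ _) (Nat.sub_lt hn one_pos)⟩ := by
      ext
      simp [hk, hle]
    unfold rho
    rw [dif_pos hn, hk']
  have hkS : (k : ℕ) ∈ S := hk ▸ Nat.sInf_mem ⟨_, hmem⟩
  have hhalf : ∑ i, s i ^ 2 ≤ 2 * ∑ i : Fin n, (if (i : ℕ) ≤ k then s i ^ 2 else 0) := by
    have := hsplit k
    have h2 := (hmemS k).mp hkS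
    linarith
  rw [hrho, ← hsum]
  by_cases hzero : s k = 0
  · have hall : ∑ i, s i ^ 2 ≤ 0 := by
      rcases Nat.eq_zero_or_pos (k : ℕ) with h0 | h0
      · refine Finset.sum_nonpos fun i _ => ?_
        have h1 : s i ≤ s k := hs_anti (by rw [Fin.le_def]; omega)
        have h2 : s i = 0 := le_antisymm (h1.trans hzero.le) (hs0 i)
        simp [h2]
      · have h1 : (k : ℕ) - 1 ∉ S := Nat.notMem_of_lt_sInf (by omega)
        have h2 := not_le.mp (mt (hmemS _).mpr h1)
        have h3 : ∑ i : Fin n, (if (k : ℕ) - 1 < (i : ℕ) then s i ^ 2 else 0) ≤ 0 := by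
          refine Finset.sum_nonpos fun i _ => ?_
          split_ifs with h
          · have h4 : s i ≤ s k := hs_anti (by rw [Fin.le_def]; omega)
            have h5 : s i = 0 := le_antisymm (h4.trans hzero.le) (hs0 i)
            simp [h5]
          · rfl
        linarith [hsplit ((k : ℕ) - 1)]
    simp only [hzero, ne_eq, not_true_eq_false, if_false, Real.log_one]
    refine ⟨le_rfl, ?_⟩
    nlinarith [sq_nonneg m]
  · have hkpos : 0 < s k := lt_of_le_of_ne (hs0 k) (Ne.symm hzero)
    rw [if_pos hzero]
    refine ⟨(one_le_div hkpos).mpr (hs_anti (Fin.mk_le_of_le_val (Nat.zero_le _))), ?_⟩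
    set t : ℕ → ℝ := fun i => if h : i < n then s ⟨i, h⟩ else 0 with ht
    have htval : ∀ i : Fin n, t i = s i := fun i => by simp [ht]
    have ht_anti : Antitone t := by
      intro i j hij
      by_cases hj : j < n
      · simp only [ht, hj, hij.trans_lt hj, dif_pos]
        exact hs_anti hij
      · simp only [ht, hj, dif_neg, not_false_eq_true]
        split_ifs
        exacts [hs0 _, le_rfl]
    have hpre : ∀ (f : ℝ → ℝ) (j : ℕ), j < n → ∑ i ∈ Finset.range (j + 1), f (t i) =
        ∑ i ∈ Finset.univ.filter (fun i : Fin n => (i : ℕ) ≤ j), f (s i) := by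
      intro f j hj
      symm
      refine Finset.sum_bij (fun i _ => (i : ℕ)) ?_ ?_ ?_ ?_
      · intro i hi
        simpa [Nat.lt_succ_iff] using hi
      · intro a _ b _ h
        exact Fin.ext h
      · intro b hb
        have hb' : b < j + 1 := Finset.mem_range.mp hb
        exact ⟨⟨b, by omega⟩, by simp; omega, rfl⟩
      · intro i _
        rw [htval]
    have hP : ∀ j ≤ (k : ℕ), ∑ i ∈ Finset.range (j + 1), t i ≤ m * √((j : ℝ) + 1) := by
      intro j hj
      have hjn : j < n := by omega
      have hcard : (Finset.univ.filter (fun i : Fin n => (i : ℕ) ≤ j)).card = j + 1 := by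
        have := hpre (fun _ => 1) j hjn
        simp only [Finset.sum_const, Finset.card_range, nsmul_eq_mul, mul_one] at this
        exact_mod_cast this.symm
      have h1 := hpre id j hjn
      simp only [id] at h1
      rw [h1]
      have h2 := hX ((Finset.univ.filter (fun i : Fin n => (i : ℕ) ≤ j)).map e.toEmbedding)
      rw [Finset.sum_map, Finset.card_map, hcard] at h2
      push_cast at h2
      exact h2
    have h1 := sum_sq_le_of_partial_sums_le ht_anti k (by rwa [htval]) hP
    rw [hpre (· ^ 2) k k.2, htval, Finset.sum_filter] at h1
    have h2 : t 0 = s ⟨0, hn⟩ := htval ⟨0, hn⟩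
    rw [h2] at h1
    linarith

/-- A norm bound on all partial sums of `a` extends, up to a harmonic factor, to all
non-negative combinations. -/
lemma norm_sum_smul_sub_le {ι E : Type*} [NormedAddCommGroup E] [NormedSpace ℝ E]
    (a : ι → E) (x : ι → ℝ) (s : Finset ι) (C : ℝ) (hx : ∀ i, 0 ≤ x i)
    (ha : ∀ Y ⊆ s, ‖∑ i ∈ Y, a i‖ ≤ C * √(Y.card : ℝ)) :
    ∃ T : ℝ, 0 ≤ T ∧ T ^ 2 ≤ (harmonic s.card : ℝ) * ∑ i ∈ s, x i ^ 2 ∧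
      ∀ c, (∀ i ∈ s, c ≤ x i) →
        ‖∑ i ∈ s, (x i - c) • a i‖ ≤ C * (T - c * √(s.card : ℝ)) := by
  classical
  induction s using Finset.induction_on_max_value (fun i => - x i) with
  | empty => exact ⟨0, le_rfl, by simp, by simp⟩
  | insert b s hb hmax ih =>
    obtain ⟨T, hT0, hT, hbound⟩ := ih fun Y hY => ha Y (hY.trans (Finset.subset_insert _ _))
    have hcard : ((insert b s).card : ℝ) = s.card + 1 := by
      rw [Finset.card_insert_of_notMem hb]; push_cast; rfl
    set p := √(s.card : ℝ) with hp
    set q := √((s.card : ℝ) + 1) with hq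
    have hp0 : 0 ≤ p := Real.sqrt_nonneg _
    have hq0 : 0 < q := by positivity
    have hpq : p ≤ q := Real.sqrt_le_sqrt (by linarith)
    have hp2 : p ^ 2 = s.card := Real.sq_sqrt (by positivity)
    have hq2 : q ^ 2 = s.card + 1 := Real.sq_sqrt (by positivity)
    have hδ : (q - p) ^ 2 ≤ ((s.card : ℝ) + 1)⁻¹ := by
      rw [← hq2, ← inv_pow]
      refine pow_le_pow_left₀ (by linarith) ?_ 2
      rw [← one_div, le_div_iff₀ hq0]
      nlinarith
    refine ⟨T + x b * (q - p), by have := hx b; nlinarith, ?_, ?_⟩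
    · rw [Finset.card_insert_of_notMem hb, harmonic_succ, Finset.sum_insert hb]
      push_cast
      have hH : (0 : ℝ) ≤ harmonic s.card := by
        exact_mod_cast Finset.sum_nonneg fun i _ => by positivity
      set H : ℝ := (harmonic s.card : ℝ)
      have hQ : 0 ≤ ∑ i ∈ s, x i ^ 2 := Finset.sum_nonneg fun i _ => sq_nonneg _
      set Q := ∑ i ∈ s, x i ^ 2
      have h1 : (T + x b * (q - p)) ^ 2 ≤ (H + (q - p) ^ 2) * (x b ^ 2 + Q) := by
        have hd : 0 ≤ q - p := by linarith
        set δ := q - p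
        have h2 : (T * (x b * δ)) ^ 2 ≤ (H * x b ^ 2) * (δ ^ 2 * Q) := by
          have := mul_le_mul_of_nonneg_right hT (sq_nonneg (x b * δ))
          nlinarith
        have h3 : 2 * (T * (x b * δ)) ≤ H * x b ^ 2 + δ ^ 2 * Q := by
          refine (abs_le_of_sq_le_sq' ?_ (by positivity)).2
          nlinarith [sq_nonneg (H * x b ^ 2 - δ ^ 2 * Q)]
        nlinarith
      refine h1.trans ?_
      gcongr
    · intro c hc
      have hcb : c ≤ x b := hc b (Finset.mem_insert_self _ _)
      have h1 := hbound (x b) fun i hi => by linarith [hmax i hi]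
      have h2 := ha (insert b s) subset_rfl
      rw [hcard] at h2 ⊢
      have h3 : ∑ i ∈ insert b s, (x i - c) • a i =
          ∑ i ∈ s, (x i - x b) • a i + (x b - c) • ∑ i ∈ insert b s, a i := by
        rw [Finset.sum_insert hb, Finset.sum_insert hb, smul_add, Finset.smul_sum,
          add_left_comm, ← Finset.sum_add_distrib]
        congr 1
        refine Finset.sum_congr rfl fun i _ => ?_
        rw [← add_smul]
        congr 1
        ring
      rw [h3]
      calc _ ≤ ‖∑ i ∈ s, (x i - x b) • a i‖ + ‖(x b - c) • ∑ i ∈ insert b s, a i‖ :=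
            norm_add_le _ _
        _ ≤ C * (T - x b * p) + (x b - c) * (C * q) := by
            rw [norm_smul, Real.norm_of_nonneg (sub_nonneg.mpr hcb)]
            gcongr
        _ = _ := by ring

/-- The squared-norm form of `norm_sum_smul_sub_le`, with `c = 0`. -/
lemma norm_sum_smul_le_of_norm_sum_le {ι E : Type*} [NormedAddCommGroup E] [NormedSpace ℝ E]
    (a : ι → E) (x : ι → ℝ) (s : Finset ι) {C : ℝ} (hx : ∀ i, 0 ≤ x i)
    (ha : ∀ Y ⊆ s, ‖∑ i ∈ Y, a i‖ ≤ C * √(Y.card : ℝ)) :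
    ‖∑ i ∈ s, x i • a i‖ ^ 2 ≤ C ^ 2 * (1 + Real.log s.card) * ∑ i ∈ s, x i ^ 2 := by
  obtain ⟨T, -, hT, h⟩ := norm_sum_smul_sub_le a x s C hx ha
  have h1 := h 0 fun i _ => hx i
  simp only [sub_zero, zero_mul] at h1
  have hQ : 0 ≤ ∑ i ∈ s, x i ^ 2 := Finset.sum_nonneg fun i _ => sq_nonneg _
  calc _ ≤ (C * T) ^ 2 := by gcongr
    _ = C ^ 2 * T ^ 2 := by ring
    _ ≤ C ^ 2 * ((1 + Real.log s.card) * ∑ i ∈ s, x i ^ 2) := by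
        gcongr
        refine hT.trans ?_
        gcongr
        exact harmonic_le_one_add_log _
    _ = _ := by ring

open Classical in
lemma dotProduct_adjMatrix_mulVec_le {V : Type*} [Fintype V] (G : SimpleGraph V) (z : V → ℝ) :
    z ⬝ᵥ (G.adjMatrix ℝ).mulVec z ≤ lamMax G * (z ⬝ᵥ z) := by
  have hfin : (spectrum ℝ (G.adjMatrix ℝ)).Finite := Matrix.finite_real_spectrum
  have hpsd : (algebraMap ℝ (Matrix V V ℝ) (lamMax G) - G.adjMatrix ℝ).PosSemidef := by
    rw [Matrix.posSemidef_iff_isHermitian_and_spectrum_nonneg]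
    constructor
    · refine Matrix.IsHermitian.sub ?_ (G.isHermitian_adjMatrix ℝ)
      rw [Matrix.algebraMap_eq_diagonal]
      exact Matrix.isHermitian_diagonal _
    · rw [← spectrum.singleton_sub_eq]
      rintro _ ⟨_, rfl, μ, hμ, rfl⟩
      exact sub_nonneg.mpr (le_csSup hfin.bddAbove hμ)
  have h := hpsd.dotProduct_mulVec_nonneg z
  rw [Matrix.sub_mulVec, Algebra.algebraMap_eq_smul_one, Matrix.smul_mulVec, Matrix.one_mulVec,
    dotProduct_sub, dotProduct_smul, star_trivial, smul_eq_mul] at h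
  linarith

open Classical in
lemma lamMax_le {V : Type*} [Fintype V] (G : SimpleGraph V) {B : ℝ} (hB : 0 ≤ B)
    (h : ∀ (μ : ℝ) (v : V → ℝ), v ≠ 0 → (G.adjMatrix ℝ).mulVec v = μ • v → μ ≤ B) :
    lamMax G ≤ B := by
  refine Real.sSup_le (fun μ hμ => ?_) hB
  rw [← Matrix.spectrum_toLin', ← Module.End.hasEigenvalue_iff_mem_spectrum] at hμ
  obtain ⟨v, hv⟩ := hμ.exists_hasEigenvector
  exact h μ v hv.2 (by simpa using hv.apply_eq_smul)

lemma eXY_eq_sum {V : Type*} [Fintype V] (G : SimpleGraph V) [DecidableRel G.Adj]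
    (X Y : Finset V) : eXY G X Y = ∑ x ∈ X, (Y.filter fun y => G.Adj x y).card := by
  classical
  simp only [eXY, Finset.card_filter, Finset.sum_product]
  refine Finset.sum_congr rfl fun x _ => Finset.sum_congr rfl fun y _ => ?_
  congr

open Classical in
lemma dotProduct_adjMatrix_mulVec_le_add {V : Type*} [Fintype V] (G : SimpleGraph V)
    (x y : V → ℝ) :
    2 * (x ⬝ᵥ (G.adjMatrix ℝ).mulVec y) ≤ lamMax G * (x ⬝ᵥ x + y ⬝ᵥ y) := by
  have h1 := dotProduct_adjMatrix_mulVec_le G (x + y)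
  have h2 := dotProduct_adjMatrix_mulVec_le G fun v => |(x - y) v|
  have h3 : -((x - y) ⬝ᵥ (G.adjMatrix ℝ).mulVec (x - y)) ≤
      (fun v => |(x - y) v|) ⬝ᵥ (G.adjMatrix ℝ).mulVec (fun v => |(x - y) v|) := by
    simp only [dotProduct, Matrix.mulVec, Finset.mul_sum, ← Finset.sum_neg_distrib]
    refine Finset.sum_le_sum fun v _ => Finset.sum_le_sum fun w _ => ?_
    refine (neg_le_abs _).trans (le_of_eq ?_)
    rw [abs_mul, abs_mul]
    congr 2
    rw [SimpleGraph.adjMatrix_apply]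
    split_ifs <;> simp
  have h4 : (fun v => |(x - y) v|) ⬝ᵥ (fun v => |(x - y) v|) = (x - y) ⬝ᵥ (x - y) := by
    simp [dotProduct]
  have hsymm : y ⬝ᵥ (G.adjMatrix ℝ).mulVec x = x ⬝ᵥ (G.adjMatrix ℝ).mulVec y := by
    rw [Matrix.dotProduct_mulVec, ← Matrix.mulVec_transpose, SimpleGraph.transpose_adjMatrix,
      dotProduct_comm]
  rw [h4] at h2
  simp only [Matrix.mulVec_add, Matrix.mulVec_sub, dotProduct_add, dotProduct_sub,
    add_dotProduct, sub_dotProduct, hsymm, dotProduct_comm y x] at h1 h2 h3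
  linarith

lemma eXY_le_lamMax_mul {V : Type*} [Fintype V] (G : SimpleGraph V) {X Y : Finset V}
    (hX : X.Nonempty) (hY : Y.Nonempty) :
    (eXY G X Y : ℝ) ≤ lamMax G * √((X.card : ℝ) * (Y.card : ℝ)) := by
  classical
  have hX' : (0 : ℝ) < X.card := by exact_mod_cast hX.card_pos
  have hY' : (0 : ℝ) < Y.card := by exact_mod_cast hY.card_pos
  rw [Real.sqrt_mul hX'.le]
  set p := √(X.card : ℝ) with hp
  set q := √(Y.card : ℝ) with hq
  have hp0 : 0 < p := Real.sqrt_pos.mpr hX'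
  have hq0 : 0 < q := Real.sqrt_pos.mpr hY'
  have hp2 : p ^ 2 = X.card := Real.sq_sqrt hX'.le
  have hq2 : q ^ 2 = Y.card := Real.sq_sqrt hY'.le
  have h := dotProduct_adjMatrix_mulVec_le_add G (fun v => if v ∈ X then q else 0)
    (fun v => if v ∈ Y then p else 0)
  have h1 : (fun v => if v ∈ X then q else 0) ⬝ᵥ (fun v => if v ∈ X then q else 0) =
      p ^ 2 * q ^ 2 := by
    simp [dotProduct, hp2, sq]
  have h2 : (fun v => if v ∈ Y then p else 0) ⬝ᵥ (fun v => if v ∈ Y then p else 0) =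
      p ^ 2 * q ^ 2 := by
    simp [dotProduct, hq2, sq]
    ring
  have h3 : (fun v => if v ∈ X then q else 0) ⬝ᵥ
      (G.adjMatrix ℝ).mulVec (fun v => if v ∈ Y then p else 0) = p * q * eXY G X Y := by
    simp only [eXY_eq_sum, Finset.card_filter, dotProduct, Matrix.mulVec,
      SimpleGraph.adjMatrix_apply, Nat.cast_sum, Nat.cast_ite, Nat.cast_one, Nat.cast_zero,
      Finset.mul_sum, ite_mul, mul_ite, mul_zero, zero_mul, one_mul, mul_one,
      Finset.sum_ite_mem, Finset.univ_inter]
    rw [← Finset.sum_subset (Finset.subset_univ X) fun x _ hx => by simp [hx]]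
    refine Finset.sum_congr rfl fun x hx => ?_
    simp only [hx, if_true, mul_comm q p]
  rw [h1, h2, h3] at h
  refine le_of_mul_le_mul_left ?_ (mul_pos hp0 hq0)
  linarith

lemma bddAbove_ratios {V : Type*} [Fintype V] (G : SimpleGraph V) :
    BddAbove {r : ℝ | ∃ X Y : Finset V, X.Nonempty ∧ Y.Nonempty ∧
      r = (eXY G X Y : ℝ) / √((X.card : ℝ) * (Y.card : ℝ))} := by
  refine ((Set.finite_range fun p : Finset V × Finset V =>
    (eXY G p.1 p.2 : ℝ) / √((p.1.card : ℝ) * (p.2.card : ℝ))).subset ?_).bddAbove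
  rintro _ ⟨X, Y, -, -, rfl⟩
  exact ⟨(X, Y), rfl⟩

lemma MG_nonneg {V : Type*} [Fintype V] (G : SimpleGraph V) : 0 ≤ MG G := by
  refine Real.sSup_nonneg ?_
  rintro _ ⟨X, Y, -, -, rfl⟩
  positivity

lemma eXY_le_MG_mul {V : Type*} [Fintype V] (G : SimpleGraph V) (X Y : Finset V) :
    (eXY G X Y : ℝ) ≤ MG G * √((X.card : ℝ) * (Y.card : ℝ)) := by
  have h0 : (0 : ℝ) ≤ MG G * √((X.card : ℝ) * (Y.card : ℝ)) :=
    mul_nonneg (MG_nonneg G) (Real.sqrt_nonneg _)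
  rcases X.eq_empty_or_nonempty with rfl | hX
  · simp [eXY]
  rcases Y.eq_empty_or_nonempty with rfl | hY
  · simp [eXY]
  have hpos : 0 < √((X.card : ℝ) * (Y.card : ℝ)) :=
    Real.sqrt_pos.mpr (by exact_mod_cast Nat.mul_pos hX.card_pos hY.card_pos)
  rw [← div_le_iff₀ hpos]
  exact le_csSup (bddAbove_ratios G) ⟨X, Y, hX, hY, rfl⟩

/-- Theorem 3′: for a bipartite graph with partite sets `U`, `W`, with `d_Y(u)` the number
of neighbors of `u` in `Y` and `K = max_{∅ ≠ Y ⊆ W} ρ((d_Y(u))_{u ∈ U})`,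
`M(G) ≤ λmax(G) ≤ √(2·(log K + 1)·(log|W| + 4))·M(G)`. -/
theorem statement11 {V : Type*} [Fintype V] (G : SimpleGraph V) [DecidableRel G.Adj]
    (U W : Finset V) (hU : U.Nonempty) (hW : W.Nonempty)
    (hdisj : Disjoint U W) (hcover : ∀ v : V, v ∈ U ∨ v ∈ W)
    (hbip : ∀ a b, G.Adj a b → (a ∈ U ∧ b ∈ W) ∨ (a ∈ W ∧ b ∈ U))
    (K : ℝ)
    (hK : K = sSup {r : ℝ | ∃ Y : Finset V, Y.Nonempty ∧ Y ⊆ W ∧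
      r = rho (fun i : Fin (Fintype.card ↥U) =>
        ((Y.filter fun y => G.Adj (((Fintype.equivFin ↥U).symm i : ↥U) : V) y).card : ℝ))}) :
    MG G ≤ lamMax G ∧
      lamMax G ≤ Real.sqrt (2 * (Real.log K + 1) *
        (Real.log (W.card : ℝ) + 4)) * MG G := by
  classical
  have hM0 := MG_nonneg G
  refine ⟨?_, ?_⟩
  · refine csSup_le ⟨_, U, W, hU, hW, rfl⟩ ?_
    rintro _ ⟨X, Y, hX, hY, rfl⟩
    have hpos : 0 < √((X.card : ℝ) * (Y.card : ℝ)) :=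
      Real.sqrt_pos.mpr (by exact_mod_cast Nat.mul_pos hX.card_pos hY.card_pos)
    rw [div_le_iff₀ hpos]
    exact eXY_le_lamMax_mul G hX hY
  set d : Finset V → Fin (Fintype.card ↥U) → ℝ := fun Y i =>
    ((Y.filter fun y => G.Adj (((Fintype.equivFin ↥U).symm i : ↥U) : V) y).card : ℝ) with hd
  have hdX : ∀ (Y : Finset V) (X : Finset (Fin (Fintype.card ↥U))),
      ∑ i ∈ X, d Y i ≤ MG G * √(Y.card : ℝ) * √(X.card : ℝ) := by
    intro Y X
    have h := eXY_le_MG_mul G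
      (X.map ((Fintype.equivFin ↥U).symm.toEmbedding.trans (Function.Embedding.subtype _))) Y
    rw [eXY_eq_sum, Finset.sum_map, Finset.card_map, mul_comm (X.card : ℝ),
      Real.sqrt_mul (Nat.cast_nonneg _), ← mul_assoc, Nat.cast_sum] at h
    exact h
  have hrho := fun Y => one_le_rho_and_sum_sq_le (d Y) (fun i => Nat.cast_nonneg _) _ (hdX Y)
  have hbdd : BddAbove {r : ℝ | ∃ Y : Finset V, Y.Nonempty ∧ Y ⊆ W ∧ r = rho (d Y)} := by
    refine ((Set.finite_range fun Y => rho (d Y)).subset ?_).bddAbove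
    rintro _ ⟨Y, -, -, rfl⟩
    exact ⟨Y, rfl⟩
  have hrhoK : ∀ Y : Finset V, Y.Nonempty → Y ⊆ W → rho (d Y) ≤ K := fun Y hY hYW =>
    hK ▸ le_csSup hbdd ⟨Y, hY, hYW, rfl⟩
  have hK1 : 1 ≤ K := (hrho W).1.trans (hrhoK W hW subset_rfl)
  have hlogK : 0 ≤ Real.log K := Real.log_nonneg hK1
  have hlogW : 0 ≤ Real.log (W.card : ℝ) := Real.log_natCast_nonneg _
  have hWcompl : W = Uᶜ := by
    ext v
    rw [Finset.mem_compl]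
    exact ⟨fun h h' => Finset.disjoint_left.mp hdisj h' h, (hcover v).resolve_left⟩
  have hsplit : ∀ f : V → ℝ, ∑ v, f v = ∑ v ∈ U, f v + ∑ v ∈ W, f v := fun f => by
    rw [hWcompl, Finset.sum_add_sum_compl]
  have hUU : ∀ u ∈ U, ∀ w ∈ U, ¬ G.Adj u w := fun u hu w hw h => by
    rcases hbip u w h with h | h
    · exact Finset.disjoint_left.mp hdisj hw h.2
    · exact Finset.disjoint_left.mp hdisj hu h.1
  have hWW : ∀ u ∈ W, ∀ w ∈ W, ¬ G.Adj u w := fun u hu w hw h => by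
    rcases hbip u w h with h | h
    · exact Finset.disjoint_left.mp hdisj h.1 hu
    · exact Finset.disjoint_left.mp hdisj h.2 hw
  set A : V → V → ℝ := fun u w => if G.Adj u w then 1 else 0 with hA
  have hA0 : ∀ u w, 0 ≤ A u w := fun u w => by simp only [hA]; split_ifs <;> norm_num
  have hAsymm : ∀ u w, A u w = A w u := fun u w => by simp only [hA, G.adj_comm]
  have hAU : ∀ u ∈ U, ∀ w ∈ U, A u w = 0 := fun u hu w hw => if_neg (hUU u hu w hw)
  have hAW : ∀ u ∈ W, ∀ w ∈ W, A u w = 0 := fun u hu w hw => if_neg (hWW u hu w hw)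
  set a : V → EuclideanSpace ℝ V := fun w => WithLp.toLp 2 fun u => A u w with ha
  have hnorm : ∀ (Y : Finset V) (x : V → ℝ),
      ‖∑ w ∈ Y, x w • a w‖ ^ 2 = ∑ u, (∑ w ∈ Y, x w * A u w) ^ 2 := fun Y x => by
    rw [EuclideanSpace.real_norm_sq_eq]
    simp [ha]
  set C : ℝ := √(2 * (Real.log K + 1)) * MG G with hC
  have hC0 : 0 ≤ C := by positivity
  have hC2 : C ^ 2 = 2 * (Real.log K + 1) * MG G ^ 2 := by
    rw [hC, mul_pow, Real.sq_sqrt (by positivity)]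
  have hbound : ∀ Y ⊆ W, ‖∑ w ∈ Y, a w‖ ≤ C * √(Y.card : ℝ) := by
    intro Y hYW
    rcases Y.eq_empty_or_nonempty with rfl | hY
    · simp
    refine abs_le_of_sq_le_sq' ?_ (by positivity) |>.2
    have h1 := hnorm Y 1
    simp only [Pi.one_apply, one_smul, one_mul] at h1
    have h2 : ∑ u ∈ W, (∑ w ∈ Y, A u w) ^ 2 = 0 :=
      Finset.sum_eq_zero fun u hu => by
        rw [Finset.sum_eq_zero fun w hw => hAW u hu w (hYW hw), sq, zero_mul]
    have h3 : ∑ u ∈ U, (∑ w ∈ Y, A u w) ^ 2 = ∑ i, d Y i ^ 2 := by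
      rw [← Finset.sum_coe_sort U, ← Equiv.sum_comp (Fintype.equivFin ↥U).symm]
      refine Finset.sum_congr rfl fun i _ => ?_
      simp [hd, hA]
    rw [h1, hsplit, h2, h3, add_zero, mul_pow, hC2, Real.sq_sqrt (Nat.cast_nonneg _)]
    have h4 := (hrho Y).2
    rw [mul_pow, Real.sq_sqrt (Nat.cast_nonneg _)] at h4
    have h5 : Real.log (rho (d Y)) ≤ Real.log K :=
      Real.log_le_log (zero_lt_one.trans_le (hrho Y).1) (hrhoK Y hY hYW)
    calc _ ≤ _ := h4
      _ ≤ 2 * (MG G ^ 2 * (Y.card : ℝ)) * (1 + Real.log K) := by gcongr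
      _ = _ := by ring
  refine lamMax_le G (by positivity) fun μ v hv hμv => ?_
  rcases le_or_gt μ 0 with hμ | hμ
  · exact hμ.trans (by positivity)
  have heig : ∀ u, ∑ w, A u w * v w = μ * v u := fun u => by
    have := congrFun hμv u
    simpa [Matrix.mulVec, dotProduct, hA, SimpleGraph.adjMatrix_apply] using this
  have heigU : ∀ u ∈ U, ∑ w ∈ W, A u w * v w = μ * v u := fun u hu => by
    rw [← heig u, hsplit, Finset.sum_eq_zero (s := U) fun w hw => by rw [hAU u hu w hw, zero_mul],
      zero_add]
  have heigW : ∀ u ∈ W, ∑ w ∈ U, A u w * v w = μ * v u := fun u hu => by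
    rw [← heig u, hsplit, Finset.sum_eq_zero (s := W) fun w hw => by rw [hAW u hu w hw, zero_mul],
      add_zero]
  have hUW : ∑ u ∈ U, v u ^ 2 = ∑ w ∈ W, v w ^ 2 := by
    refine mul_left_cancel₀ hμ.ne' ?_
    rw [Finset.mul_sum, Finset.mul_sum]
    calc ∑ u ∈ U, μ * v u ^ 2 = ∑ u ∈ U, ∑ w ∈ W, A u w * v w * v u :=
          Finset.sum_congr rfl fun u hu => by rw [← Finset.sum_mul, heigU u hu]; ring
      _ = ∑ w ∈ W, ∑ u ∈ U, A w u * v u * v w := by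
          rw [Finset.sum_comm]
          refine Finset.sum_congr rfl fun w _ => Finset.sum_congr rfl fun u _ => ?_
          rw [hAsymm]
          ring
      _ = _ := Finset.sum_congr rfl fun u hu => by rw [← Finset.sum_mul, heigW u hu]; ring
  have hpos : 0 < ∑ w ∈ W, v w ^ 2 := by
    obtain ⟨w, hw⟩ := Function.ne_iff.mp hv
    have h1 : 0 < ∑ w, v w ^ 2 :=
      Finset.sum_pos' (fun _ _ => sq_nonneg _) ⟨w, Finset.mem_univ _, by
        have : v w ≠ 0 := hw
        positivity⟩
    rw [hsplit, hUW] at h1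
    linarith
  have hmain := norm_sum_smul_le_of_norm_sum_le a (fun w => |v w|) W (fun _ => abs_nonneg _) hbound
  have hlow : μ ^ 2 * ∑ w ∈ W, v w ^ 2 ≤ ‖∑ w ∈ W, |v w| • a w‖ ^ 2 := by
    rw [hnorm, ← hUW, Finset.mul_sum]
    calc _ ≤ ∑ u ∈ U, (∑ w ∈ W, |v w| * A u w) ^ 2 := by
          refine Finset.sum_le_sum fun u hu => ?_
          rw [← mul_pow, ← heigU u hu, ← sq_abs]
          refine pow_le_pow_left₀ (abs_nonneg _) ((Finset.abs_sum_le_sum_abs _ _).trans_eq ?_) 2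
          exact Finset.sum_congr rfl fun w _ => by rw [abs_mul, abs_of_nonneg (hA0 u w), mul_comm]
      _ ≤ _ := Finset.sum_le_sum_of_subset_of_nonneg (Finset.subset_univ _)
          fun _ _ _ => sq_nonneg _
  simp only [sq_abs] at hmain
  have hμ2 : μ ^ 2 ≤ C ^ 2 * (1 + Real.log W.card) :=
    le_of_mul_le_mul_right (hlow.trans hmain) hpos
  refine abs_le_of_sq_le_sq' ?_ (by positivity) |>.2
  rw [mul_pow, Real.sq_sqrt (by positivity)]
  calc μ ^ 2 ≤ _ := hμ2
    _ ≤ C ^ 2 * (Real.log W.card + 4) := by gcongr ?_ * ?_; linarith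
    _ = _ := by rw [hC2]; ring
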